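/- arXiv:1207.2713 — 2 statements merged into one kernel-verified Lean document; each statement's English description precedes it below -/
import Mathlib

section
/- Under the same hypotheses, u₂ = Σ_{k=0}^∞ (λ^k/(2k+1)!) φ_{2k+1} is a C² solution of u'' − q u = λ u on (a,b), and u₁, u₂ are linearly independent; in particular every solution of u'' − q u = λ u is a linear combination c₁u₁ + c₂u₂. -/
open Set Filter MeasureTheory intervalIntegral

/-- Recursive integrals `X^{(n)}` based at `x₀`. -/
noncomputable def Xrec (f : ℝ → ℂ) (x₀ : ℝ) : ℕ → ℝ → ℂ
  | 0, _ => 1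
  | n + 1, x => ((n : ℂ) + 1) * ∫ s in x₀..x, Xrec f x₀ n s * (f s ^ 2) ^ ((-1 : ℤ) ^ (n + 1))

/-- Recursive integrals `X̃^{(n)}` based at `x₀`. -/
noncomputable def Xtil (f : ℝ → ℂ) (x₀ : ℝ) : ℕ → ℝ → ℂ
  | 0, _ => 1
  | n + 1, x => ((n : ℂ) + 1) * ∫ s in x₀..x, Xtil f x₀ n s * (f s ^ 2) ^ ((-1 : ℤ) ^ n)

/-- The system of functions `φ_k`. -/
noncomputable def phi (f : ℝ → ℂ) (x₀ : ℝ) (k : ℕ) (x : ℝ) : ℂ :=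
  if Odd k then f x * Xrec f x₀ k x else f x * Xtil f x₀ k x

/-- The system of functions `ψ_k`. -/
noncomputable def psi (f : ℝ → ℂ) (x₀ : ℝ) (k : ℕ) (x : ℝ) : ℂ :=
  if Odd k then Xtil f x₀ k x / f x else Xrec f x₀ k x / f x

/-- The iterated integrals `Z₀ = 1`, `Zₙ₊₁(x) = ∫ s in x₀..x, Zₙ(s) wₙ(s)`. -/
noncomputable def iterInt (w : ℕ → ℝ → ℂ) (x₀ : ℝ) : ℕ → ℝ → ℂ
  | 0, _ => 1
  | n + 1, x => ∫ s in x₀..x, iterInt w x₀ n s * w n s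

/-- The power series in `lam` whose coefficients are every other iterated integral. -/
noncomputable def iterSeries (w : ℕ → ℝ → ℂ) (x₀ : ℝ) (lam : ℂ) (j : ℕ) (x : ℝ) : ℂ :=
  ∑' k : ℕ, lam ^ k * iterInt w x₀ (2 * k + j) x

section iterInt

variable {w : ℕ → ℝ → ℂ} {x₀ : ℝ}

theorem continuous_iterInt (hw : ∀ n, Continuous (w n)) (n : ℕ) :
    Continuous (iterInt w x₀ n) := by
  induction n with
  | zero => exact continuous_const
  | succ n ih =>
    exact continuous_primitive (fun _ _ => (ih.mul (hw n)).intervalIntegrable _ _) x₀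

theorem hasDerivAt_iterInt_succ (hw : ∀ n, Continuous (w n)) (n : ℕ) (x : ℝ) :
    HasDerivAt (iterInt w x₀ (n + 1)) (iterInt w x₀ n x * w n x) x :=
  (((continuous_iterInt hw n).mul (hw n)).integral_hasStrictDerivAt x₀ x).hasDerivAt

theorem iterInt_succ_self (n : ℕ) : iterInt w x₀ (n + 1) x₀ = 0 := by
  simp [iterInt]

theorem norm_iterInt_le {M : ℝ} (hM : ∀ n x, ‖w n x‖ ≤ M) (n : ℕ) (x : ℝ) :
    ‖iterInt w x₀ n x‖ ≤ (M * |x - x₀|) ^ n / n.factorial := by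
  have hM0 : 0 ≤ M := (norm_nonneg _).trans (hM 0 0)
  induction n generalizing x with
  | zero => simp [iterInt]
  | succ n ih =>
    have hint : IntegrableOn (fun s => M ^ (n + 1) / n.factorial * |s - x₀| ^ n) (uIoc x₀ x) :=
      (by fun_prop : Continuous fun s : ℝ =>
        M ^ (n + 1) / n.factorial * |s - x₀| ^ n).integrableOn_uIoc
    calc ‖iterInt w x₀ (n + 1) x‖
        = ‖∫ s in uIoc x₀ x, iterInt w x₀ n s * w n s‖ := norm_intervalIntegral_eq _ _ _ _
      _ ≤ ∫ s in uIoc x₀ x, M ^ (n + 1) / n.factorial * |s - x₀| ^ n := by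
        refine norm_integral_le_of_norm_le hint (ae_of_all _ fun s => ?_)
        rw [norm_mul]
        calc _ ≤ (M * |s - x₀|) ^ n / n.factorial * M :=
              mul_le_mul (ih s) (hM n s) (norm_nonneg _) (by positivity)
          _ = _ := by ring
      _ = (M * |x - x₀|) ^ (n + 1) / (n + 1).factorial := by
        rw [MeasureTheory.integral_const_mul, integral_pow_abs_sub_uIoc, Nat.factorial_succ]
        push_cast
        field_simp
        rw [mul_pow]

/-- A summable majorant for the terms of `iterSeries`. -/
theorem norm_iterSeries_term_le {M : ℝ} (hM : ∀ n x, ‖w n x‖ ≤ M) (lam : ℂ) (j k : ℕ)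
    {x R : ℝ} (hx : |x - x₀| ≤ R) :
    ‖lam ^ k * iterInt w x₀ (2 * k + j) x‖ ≤
      ((1 + ‖lam‖) * (M * R)) ^ (2 * k + j) / (2 * k + j).factorial := by
  have hM0 : 0 ≤ M := (norm_nonneg _).trans (hM 0 0)
  have hl : 1 ≤ 1 + ‖lam‖ := by simp
  have h1 : ‖lam‖ ^ k ≤ (1 + ‖lam‖) ^ (2 * k + j) :=
    (pow_le_pow_left₀ (norm_nonneg _) (by simp) k).trans
      (pow_le_pow_right₀ hl (by omega))
  have h2 : ‖iterInt w x₀ (2 * k + j) x‖ ≤ (M * R) ^ (2 * k + j) / (2 * k + j).factorial :=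
    (norm_iterInt_le hM _ x).trans (by gcongr)
  rw [norm_mul, norm_pow, mul_pow, mul_div_assoc]
  exact mul_le_mul h1 h2 (norm_nonneg _) (by positivity)

theorem summable_pow_two_mul_add_div_factorial (c : ℝ) (j : ℕ) :
    Summable fun k : ℕ => c ^ (2 * k + j) / (2 * k + j).factorial :=
  (Real.summable_pow_div_factorial c).comp_injective
    (i := fun k : ℕ => 2 * k + j) fun a b h => by simpa using h

theorem summable_iterSeries_term {M : ℝ} (hM : ∀ n x, ‖w n x‖ ≤ M) (lam : ℂ) (j : ℕ) (x : ℝ) :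
    Summable fun k : ℕ => lam ^ k * iterInt w x₀ (2 * k + j) x :=
  .of_norm_bounded (summable_pow_two_mul_add_div_factorial _ j)
    fun k => norm_iterSeries_term_le hM lam j k le_rfl

theorem hasDerivAt_iterSeries_succ {M : ℝ} (hw : ∀ n, Continuous (w n))
    (hM : ∀ n x, ‖w n x‖ ≤ M) (lam : ℂ) (j : ℕ) (hper : ∀ k, w (2 * k + j) = w j) (x : ℝ) :
    HasDerivAt (iterSeries w x₀ lam (j + 1)) (iterSeries w x₀ lam j x * w j x) x := by
  set R := |x - x₀| + 1
  have hM0 : 0 ≤ M := (norm_nonneg _).trans (hM 0 0)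
  have hx : x ∈ Metric.ball x₀ R := by simp [R, Real.dist_eq]
  have key := hasDerivAt_tsum_of_isPreconnected
    (g := fun (k : ℕ) y => lam ^ k * iterInt w x₀ (2 * k + (j + 1)) y)
    (g' := fun k y => lam ^ k * (iterInt w x₀ (2 * k + j) y * w (2 * k + j) y))
    (u := fun k => ((1 + ‖lam‖) * (M * R)) ^ (2 * k + j) / (2 * k + j).factorial * M)
    ((summable_pow_two_mul_add_div_factorial _ j).mul_right M) Metric.isOpen_ball
    (convex_ball x₀ R).isPreconnected
    (fun k y _ => (hasDerivAt_iterInt_succ hw (2 * k + j) y).const_mul _)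
    (fun k y hy => ?_) hx (summable_iterSeries_term hM lam (j + 1) x) hx
  · refine key.congr_deriv ?_
    rw [iterSeries, ← tsum_mul_right]
    simp only [hper, mul_assoc]
  · rw [← mul_assoc, norm_mul]
    rw [Metric.mem_ball, Real.dist_eq] at hy
    have h := norm_iterSeries_term_le (x₀ := x₀) hM lam j k hy.le
    exact mul_le_mul h (hM _ _) (norm_nonneg _) ((norm_nonneg _).trans h)

theorem iterSeries_zero_eq {M : ℝ} (hM : ∀ n x, ‖w n x‖ ≤ M) (lam : ℂ) (x : ℝ) :
    iterSeries w x₀ lam 0 x = 1 + lam * iterSeries w x₀ lam 2 x := by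
  rw [iterSeries, (summable_iterSeries_term hM lam 0 x).tsum_eq_zero_add, iterSeries,
    ← tsum_mul_left]
  simp only [pow_succ', mul_assoc]
  simp [iterInt, mul_add]

theorem hasDerivAt_iterSeries_zero {M : ℝ} (hw : ∀ n, Continuous (w n))
    (hM : ∀ n x, ‖w n x‖ ≤ M) (lam : ℂ) (hper : ∀ k, w (2 * k + 1) = w 1) (x : ℝ) :
    HasDerivAt (iterSeries w x₀ lam 0) (lam * (iterSeries w x₀ lam 1 x * w 1 x)) x := by
  rw [show iterSeries w x₀ lam 0 = fun y => 1 + lam * iterSeries w x₀ lam 2 y from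
    funext (iterSeries_zero_eq hM lam)]
  exact ((hasDerivAt_iterSeries_succ hw hM lam 1 hper x).const_mul lam).const_add 1

theorem iterSeries_succ_self (lam : ℂ) (j : ℕ) : iterSeries w x₀ lam (j + 1) x₀ = 0 := by
  simp [iterSeries, ← add_assoc, iterInt_succ_self]

theorem iterSeries_zero_self {M : ℝ} (hM : ∀ n x, ‖w n x‖ ≤ M) (lam : ℂ) :
    iterSeries w x₀ lam 0 x₀ = 1 := by
  rw [iterSeries_zero_eq hM, iterSeries_succ_self, mul_zero, add_zero]

end iterInt

/-- The sequence of functions alternating between `p` (even indices) and `r` (odd indices). -/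
noncomputable def alternate (p r : ℝ → ℂ) (n : ℕ) : ℝ → ℂ := if Even n then p else r

theorem Xrec_eq_factorial_mul_iterInt {f p r : ℝ → ℂ} {a b x₀ : ℝ} (hx₀ : x₀ ∈ Icc a b)
    (hp : ∀ x ∈ Icc a b, p x = (f x ^ 2)⁻¹) (hr : ∀ x ∈ Icc a b, r x = f x ^ 2)
    (n : ℕ) : ∀ x ∈ Icc a b, Xrec f x₀ n x = n.factorial * iterInt (alternate p r) x₀ n x := by
  induction n with
  | zero => simp [Xrec, iterInt]
  | succ n ih =>
    intro x hx
    rw [Xrec, iterInt, Nat.factorial_succ, Nat.cast_mul, mul_assoc,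
      ← intervalIntegral.integral_const_mul (n.factorial : ℂ)]
    push_cast
    congr 1
    refine intervalIntegral.integral_congr fun s hs => ?_
    have hs' := uIcc_subset_Icc hx₀ hx hs
    simp only [ih s hs', mul_assoc]
    rcases Nat.even_or_odd n with h | h
    · simp [alternate, h, hp s hs', h.add_one.neg_one_pow]
    · simp [alternate, Nat.not_even_iff_odd.2 h, hr s hs', h.add_one.neg_one_pow]

theorem Xtil_eq_factorial_mul_iterInt {f p r : ℝ → ℂ} {a b x₀ : ℝ} (hx₀ : x₀ ∈ Icc a b)
    (hp : ∀ x ∈ Icc a b, p x = (f x ^ 2)⁻¹) (hr : ∀ x ∈ Icc a b, r x = f x ^ 2)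
    (n : ℕ) : ∀ x ∈ Icc a b, Xtil f x₀ n x = n.factorial * iterInt (alternate r p) x₀ n x := by
  induction n with
  | zero => simp [Xtil, iterInt]
  | succ n ih =>
    intro x hx
    rw [Xtil, iterInt, Nat.factorial_succ, Nat.cast_mul, mul_assoc,
      ← intervalIntegral.integral_const_mul (n.factorial : ℂ)]
    push_cast
    congr 1
    refine intervalIntegral.integral_congr fun s hs => ?_
    have hs' := uIcc_subset_Icc hx₀ hx hs
    simp only [ih s hs', mul_assoc]
    rcases Nat.even_or_odd n with h | h
    · simp [alternate, h, hr s hs', h.neg_one_pow]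
    · simp [alternate, Nat.not_even_iff_odd.2 h, hp s hs', h.neg_one_pow]

/-- Solutions `(A, B)` and `(C, lam * D)` of the first-order system `v' = g / f²`,
`g' = lam * f² * v` with unit Wronskian, which express both series as multiples of `f`. -/
theorem exists_system_solutions {f : ℝ → ℂ} {a b x₀ : ℝ} (hx₀ : x₀ ∈ Icc a b)
    (hf : ContinuousOn f (Icc a b)) (hfne : ∀ x ∈ Icc a b, f x ≠ 0) (lam : ℂ) :
    ∃ A B C D : ℝ → ℂ,
      (∀ x ∈ Icc a b, ∑' k : ℕ, lam ^ k / (Nat.factorial (2 * k) : ℂ) * phi f x₀ (2 * k) x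
        = f x * C x) ∧
      (∀ x ∈ Icc a b, ∑' k : ℕ, lam ^ k / (Nat.factorial (2 * k + 1) : ℂ)
        * phi f x₀ (2 * k + 1) x = f x * A x) ∧
      (∀ x ∈ Icc a b, HasDerivAt A (B x * (f x ^ 2)⁻¹) x) ∧
      (∀ x ∈ Icc a b, HasDerivAt B (lam * (A x * f x ^ 2)) x) ∧
      (∀ x ∈ Icc a b, HasDerivAt C (lam * (D x * (f x ^ 2)⁻¹)) x) ∧
      (∀ x ∈ Icc a b, HasDerivAt D (C x * f x ^ 2) x) ∧
      (∀ x, C x * B x - lam * D x * A x = 1) := by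
  have hab : a ≤ b := hx₀.1.trans hx₀.2
  set r : ℝ → ℂ := IccExtend hab ((Icc a b).domRestrict fun x => f x ^ 2)
  set p : ℝ → ℂ := IccExtend hab ((Icc a b).domRestrict fun x => (f x ^ 2)⁻¹)
  have hr : ∀ x ∈ Icc a b, r x = f x ^ 2 := fun x hx => IccExtend_of_mem _ _ hx
  have hp : ∀ x ∈ Icc a b, p x = (f x ^ 2)⁻¹ := fun x hx => IccExtend_of_mem _ _ hx
  have hrO : ContinuousOn (fun x => f x ^ 2) (Icc a b) := hf.pow 2
  have hpO : ContinuousOn (fun x => (f x ^ 2)⁻¹) (Icc a b) :=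
    hrO.inv₀ fun x hx => pow_ne_zero 2 (hfne x hx)
  have hrc : Continuous r := hrO.domRestrict.Icc_extend'
  have hpc : Continuous p := hpO.domRestrict.Icc_extend'
  obtain ⟨M₁, hM₁⟩ := isCompact_Icc.exists_bound_of_continuousOn hrO
  obtain ⟨M₂, hM₂⟩ := isCompact_Icc.exists_bound_of_continuousOn hpO
  have hrM : ∀ x, ‖r x‖ ≤ max M₁ M₂ := fun x =>
    (hM₁ _ (projIcc a b hab x).2).trans (le_max_left _ _)
  have hpM : ∀ x, ‖p x‖ ≤ max M₁ M₂ := fun x =>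
    (hM₂ _ (projIcc a b hab x).2).trans (le_max_right _ _)
  have hw : ∀ n, Continuous (alternate p r n) := fun n => by
    unfold alternate; split_ifs <;> assumption
  have hw' : ∀ n, Continuous (alternate r p n) := fun n => by
    unfold alternate; split_ifs <;> assumption
  have hM : ∀ n x, ‖alternate p r n x‖ ≤ max M₁ M₂ := fun n x => by
    unfold alternate; split_ifs <;> simp only [hrM, hpM]
  have hM' : ∀ n x, ‖alternate r p n x‖ ≤ max M₁ M₂ := fun n x => by
    unfold alternate; split_ifs <;> simp only [hrM, hpM]
  have hA (x : ℝ) : HasDerivAt (iterSeries (alternate p r) x₀ lam 1)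
      (iterSeries (alternate p r) x₀ lam 0 x * p x) x := by
    simpa [alternate] using
      hasDerivAt_iterSeries_succ hw hM lam 0 (fun k => by simp [alternate]) x
  have hB (x : ℝ) : HasDerivAt (iterSeries (alternate p r) x₀ lam 0)
      (lam * (iterSeries (alternate p r) x₀ lam 1 x * r x)) x := by
    simpa [alternate] using
      hasDerivAt_iterSeries_zero hw hM lam (fun k => by simp [alternate]) x
  have hD (x : ℝ) : HasDerivAt (iterSeries (alternate r p) x₀ lam 1)
      (iterSeries (alternate r p) x₀ lam 0 x * r x) x := by
    simpa [alternate] using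
      hasDerivAt_iterSeries_succ hw' hM' lam 0 (fun k => by simp [alternate]) x
  have hC (x : ℝ) : HasDerivAt (iterSeries (alternate r p) x₀ lam 0)
      (lam * (iterSeries (alternate r p) x₀ lam 1 x * p x)) x := by
    simpa [alternate] using
      hasDerivAt_iterSeries_zero hw' hM' lam (fun k => by simp [alternate]) x
  refine ⟨_, _, _, _, fun x hx => ?_, fun x hx => ?_,
    fun x hx => hp x hx ▸ hA x, fun x hx => hr x hx ▸ hB x, fun x hx => hp x hx ▸ hC x,
    fun x hx => hr x hx ▸ hD x, fun x => ?_⟩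
  · rw [iterSeries, ← tsum_mul_left]
    refine tsum_congr fun k => ?_
    have hk : ((2 * k).factorial : ℂ) ≠ 0 := Nat.cast_ne_zero.2 (Nat.factorial_ne_zero _)
    rw [phi, if_neg (by simp), Xtil_eq_factorial_mul_iterInt hx₀ hp hr _ x hx, add_zero]
    field_simp
  · rw [iterSeries, ← tsum_mul_left]
    refine tsum_congr fun k => ?_
    have hk : ((2 * k + 1).factorial : ℂ) ≠ 0 := Nat.cast_ne_zero.2 (Nat.factorial_ne_zero _)
    rw [phi, if_pos (by simp), Xrec_eq_factorial_mul_iterInt hx₀ hp hr _ x hx]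
    field_simp
  · have hW (y : ℝ) := ((hC y).mul (hB y)).sub (((hD y).const_mul lam).mul (hA y))
    have := is_const_of_deriv_eq_zero (fun y => (hW y).differentiableAt)
      (fun y => (hW y).deriv.trans (by ring)) x x₀
    simpa [iterSeries_zero_self hM, iterSeries_zero_self hM',
      iterSeries_succ_self (w := alternate p r) lam 0] using this

theorem contDiffOn_two_of_hasDerivAt {u v z : ℝ → ℂ} {s : Set ℝ} (hs : IsOpen s)
    (hu : ∀ x ∈ s, HasDerivAt u (v x) x) (hv : ∀ x ∈ s, HasDerivAt v (z x) x)
    (hz : ContinuousOn z s) : ContDiffOn ℝ 2 u s := by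
  have hv1 : ContDiffOn ℝ 1 v s := by
    rw [show (1 : WithTop ℕ∞) = 0 + 1 by simp, contDiffOn_succ_iff_deriv_of_isOpen hs]
    refine ⟨fun x hx => (hv x hx).differentiableAt.differentiableWithinAt, by simp, ?_⟩
    exact contDiffOn_zero.2 (hz.congr fun x hx => (hv x hx).deriv)
  rw [show (2 : WithTop ℕ∞) = 1 + 1 by norm_num, contDiffOn_succ_iff_deriv_of_isOpen hs]
  exact ⟨fun x hx => (hu x hx).differentiableAt.differentiableWithinAt, by simp,
    hv1.congr fun x hx => (hu x hx).deriv⟩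

theorem ContDiffOn.hasDerivAt_and_hasDerivAt_deriv {u : ℝ → ℂ} {s : Set ℝ} (hs : IsOpen s)
    (hu : ContDiffOn ℝ 2 u s) {x : ℝ} (hx : x ∈ s) :
    HasDerivAt u (deriv u x) x ∧ HasDerivAt (deriv u) (deriv (deriv u) x) x := by
  rw [show (2 : WithTop ℕ∞) = 1 + 1 by norm_num, contDiffOn_succ_iff_deriv_of_isOpen hs] at hu
  exact ⟨(hu.1.differentiableAt (hs.mem_nhds hx)).hasDerivAt,
    ((hu.2.2.differentiableOn (by simp)).differentiableAt (hs.mem_nhds hx)).hasDerivAt⟩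

theorem IsOpen.exists_eq_const_of_hasDerivAt_zero {g : ℝ → ℂ} {s : Set ℝ} (hs : IsOpen s)
    (hs' : IsPreconnected s) (hg : ∀ x ∈ s, HasDerivAt g 0 x) : ∃ c, ∀ x ∈ s, g x = c :=
  hs.exists_is_const_of_deriv_eq_zero hs'
    (fun x hx => (hg x hx).differentiableAt.differentiableWithinAt)
    (fun x hx => (hg x hx).deriv)

theorem spps_u2_solves_and_general_solution (a b : ℝ) (hab : a < b) (q f : ℝ → ℂ)
    (hq : ContinuousOn q (Icc a b))
    (hf : ContDiffOn ℝ 2 f (Icc a b))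
    (hfeq : ∀ x ∈ Icc a b, deriv (deriv f) x = q x * f x)
    (hfne : ∀ x ∈ Icc a b, f x ≠ 0)
    (x₀ : ℝ) (hx₀ : x₀ ∈ Icc a b) (lam : ℂ)
    (u₁ u₂ : ℝ → ℂ)
    (hu₁ : u₁ = fun x => ∑' k : ℕ, lam ^ k / (Nat.factorial (2 * k) : ℂ) * phi f x₀ (2 * k) x)
    (hu₂ : u₂ = fun x => ∑' k : ℕ,
        lam ^ k / (Nat.factorial (2 * k + 1) : ℂ) * phi f x₀ (2 * k + 1) x) :
    (ContDiffOn ℝ 2 u₂ (Ioo a b) ∧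
      ∀ x ∈ Ioo a b, deriv (deriv u₂) x - q x * u₂ x = lam * u₂ x) ∧
    (∀ c₁ c₂ : ℂ, (∀ x ∈ Ioo a b, c₁ * u₁ x + c₂ * u₂ x = 0) → c₁ = 0 ∧ c₂ = 0) ∧
    (∀ u : ℝ → ℂ, ContDiffOn ℝ 2 u (Ioo a b) →
      (∀ x ∈ Ioo a b, deriv (deriv u) x - q x * u x = lam * u x) →
      ∃ c₁ c₂ : ℂ, ∀ x ∈ Ioo a b, u x = c₁ * u₁ x + c₂ * u₂ x) := by
  obtain ⟨A, B, C, D, hC_eq, hA_eq, hA, hB, hC, hD, hW⟩ :=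
    exists_system_solutions hx₀ hf.continuousOn hfne lam
  have hsub : ∀ x ∈ Ioo a b, x ∈ Icc a b := fun x hx => Ioo_subset_Icc_self hx
  have hu1 : ∀ x ∈ Ioo a b, u₁ x = f x * C x := fun x hx => by rw [hu₁, ← hC_eq x (hsub x hx)]
  have hu2 : ∀ x ∈ Ioo a b, u₂ x = f x * A x := fun x hx => by rw [hu₂, ← hA_eq x (hsub x hx)]
  clear hu₁ hu₂ hC_eq hA_eq
  have hf' := hf.mono (Ioo_subset_Icc_self)
  have hfd : ∀ x ∈ Ioo a b, HasDerivAt f (deriv f x) x ∧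
      HasDerivAt (deriv f) (q x * f x) x := fun x hx =>
    hfeq x (hsub x hx) ▸ hf'.hasDerivAt_and_hasDerivAt_deriv isOpen_Ioo hx
  refine ⟨?_, fun c₁ c₂ h => ?_, fun u hu hueq => ?_⟩
  · have h1 : ∀ x ∈ Ioo a b, HasDerivAt u₂ (deriv f x * A x + B x * (f x)⁻¹) x := by
      intro x hx
      have hne := hfne x (hsub x hx)
      refine (((hfd x hx).1.mul (hA x (hsub x hx))).congr_deriv ?_).congr_of_eventuallyEq ?_
      · field_simp
      · filter_upwards [isOpen_Ioo.mem_nhds hx] with y hy using hu2 y hy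
    have h2 : ∀ x ∈ Ioo a b, HasDerivAt (fun x => deriv f x * A x + B x * (f x)⁻¹)
        ((q x + lam) * u₂ x) x := by
      intro x hx
      have hne := hfne x (hsub x hx)
      refine (((hfd x hx).2.mul (hA x (hsub x hx))).add
        ((hB x (hsub x hx)).mul ((hfd x hx).1.inv hne))).congr_deriv ?_
      rw [hu2 x hx, Pi.inv_apply]
      field_simp
      ring
    refine ⟨contDiffOn_two_of_hasDerivAt isOpen_Ioo h1 h2 ?_, fun x hx => ?_⟩
    · exact ((hq.mono Ioo_subset_Icc_self).add continuousOn_const).mul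
        fun x hx => (h1 x hx).continuousAt.continuousWithinAt
    · have he : deriv u₂ =ᶠ[nhds x] fun x => deriv f x * A x + B x * (f x)⁻¹ := by
        filter_upwards [isOpen_Ioo.mem_nhds hx] with y hy using (h1 y hy).deriv
      rw [he.deriv_eq, (h2 x hx).deriv]
      ring
  · have h0 : ∀ x ∈ Ioo a b, c₁ * C x + c₂ * A x = 0 := fun x hx => by
      have := h x hx
      rw [hu1 x hx, hu2 x hx] at this
      exact mul_left_cancel₀ (hfne x (hsub x hx)) (by linear_combination this)
    obtain ⟨x, hx⟩ := nonempty_Ioo.2 hab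
    have hne := hfne x (hsub x hx)
    have h1 : c₁ * (lam * D x) + c₂ * B x = 0 := by
      have hd := ((hC x (hsub x hx)).const_mul c₁).add ((hA x (hsub x hx)).const_mul c₂)
      have hz : HasDerivAt (fun y => c₁ * C y + c₂ * A y) 0 x :=
        (hasDerivAt_const x (0 : ℂ)).congr_of_eventuallyEq <| by
          filter_upwards [isOpen_Ioo.mem_nhds hx] with y hy using h0 y hy
      have := hd.unique hz
      field_simp at this
      linear_combination this
    constructor
    · linear_combination -c₁ * hW x + B x * h0 x hx - A x * h1
    · linear_combination -c₂ * hW x + C x * h1 - lam * D x * h0 x hx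
  · have hud : ∀ x ∈ Ioo a b, HasDerivAt u (deriv u x) x ∧
        HasDerivAt (deriv u) ((q x + lam) * u x) x := fun x hx => by
      have h := hu.hasDerivAt_and_hasDerivAt_deriv isOpen_Ioo hx
      rwa [show deriv (deriv u) x = (q x + lam) * u x by
        linear_combination hueq x hx] at h
    have hv : ∀ x ∈ Ioo a b, HasDerivAt (fun y => u y * (f y)⁻¹)
        ((f x * deriv u x - deriv f x * u x) * (f x ^ 2)⁻¹) x := fun x hx => by
      have hne := hfne x (hsub x hx)
      refine ((hud x hx).1.mul ((hfd x hx).1.inv hne)).congr_deriv ?_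
      rw [Pi.inv_apply]
      field_simp
      ring
    have hg : ∀ x ∈ Ioo a b, HasDerivAt (fun y => f y * deriv u y - deriv f y * u y)
        (lam * f x * u x) x := fun x hx =>
      (((hfd x hx).1.mul (hud x hx).2).sub ((hfd x hx).2.mul (hud x hx).1)).congr_deriv (by ring)
    obtain ⟨c₁, hc₁⟩ := isOpen_Ioo.exists_eq_const_of_hasDerivAt_zero isPreconnected_Ioo
      (g := fun y => u y * (f y)⁻¹ * B y - (f y * deriv u y - deriv f y * u y) * A y)
      fun x hx => by
        have hne := hfne x (hsub x hx)
        refine (((hv x hx).mul (hB x (hsub x hx))).sub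
          ((hg x hx).mul (hA x (hsub x hx)))).congr_deriv ?_
        field_simp
        ring
    obtain ⟨c₂, hc₂⟩ := isOpen_Ioo.exists_eq_const_of_hasDerivAt_zero isPreconnected_Ioo
      (g := fun y => C y * (f y * deriv u y - deriv f y * u y)
        - lam * D y * (u y * (f y)⁻¹))
      fun x hx => by
        have hne := hfne x (hsub x hx)
        refine (((hC x (hsub x hx)).mul (hg x hx)).sub
          (((hD x (hsub x hx)).const_mul lam).mul (hv x hx))).congr_deriv ?_
        field_simp
        ring
    refine ⟨c₁, c₂, fun x hx => ?_⟩
    have hne := hfne x (hsub x hx)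
    rw [hu1 x hx, hu2 x hx, ← hc₁ x hx, ← hc₂ x hx]
    have hu_eq : u x * (f x)⁻¹ * f x = u x := by field_simp
    linear_combination -u x * (f x)⁻¹ * f x * hW x - hu_eq
end

section
/- If β ≠ 0 and u is the solution of u'' − q u = −β²u with u(0) = 0, u'(0) = β, then u = T_h(sin(β·)) where T_h(sin βx) = Σ_{k=0}^∞ ((−1)^k β^{2k+1}/(2k+1)!) φ_{2k+1}(x); that is, the image of sin(βx) under T_h equals the SPPS solution β·u₂ with λ = −β². -/
open Set Filter MeasureTheory intervalIntegral

section IntervalEstimates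

variable {a : ℝ} {g : ℝ → ℂ}

lemma uIcc_zero_subset_symm_Icc {x : ℝ} (hx : x ∈ Icc (-a) a) : uIcc 0 x ⊆ Icc (-a) a := by
  have ha : 0 ≤ a := by linarith [hx.1, hx.2]
  exact uIcc_subset_Icc ⟨by linarith, ha⟩ hx

lemma ContinuousOn.intervalIntegrable_zero (hg : ContinuousOn g (Icc (-a) a)) {x : ℝ}
    (hx : x ∈ Icc (-a) a) : IntervalIntegrable g volume 0 x :=
  (hg.mono (uIcc_zero_subset_symm_Icc hx)).intervalIntegrable

lemma ContinuousOn.primitive_zero (hg : ContinuousOn g (Icc (-a) a)) :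
    ContinuousOn (fun x => ∫ s in (0 : ℝ)..x, g s) (Icc (-a) a) := by
  rcases lt_or_ge a 0 with ha | ha
  · rw [Icc_eq_empty (by linarith)]
    exact continuousOn_empty _
  · have h : uIcc (-a) a = Icc (-a) a := uIcc_of_le (by linarith)
    rw [← h] at hg ⊢
    exact continuousOn_primitive_interval' hg.intervalIntegrable (by rw [h]; constructor <;> linarith)

/-- A bound of order `n` at the origin becomes one of order `n + 1` for the primitive. -/
lemma norm_primitive_zero_le_pow {K : ℝ} {n : ℕ} (hg : ContinuousOn g (Icc (-a) a))
    (hK : ∀ s ∈ Icc (-a) a, ‖g s‖ ≤ K * |s| ^ n) {x : ℝ} (hx : x ∈ Icc (-a) a) :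
    ‖∫ s in (0 : ℝ)..x, g s‖ ≤ K * (|x| ^ (n + 1) / (n + 1)) := by
  have hsub : uIoc 0 x ⊆ Icc (-a) a := uIoc_subset_uIcc.trans (uIcc_zero_subset_symm_Icc hx)
  have hint : IntegrableOn (fun s : ℝ => K * |s| ^ n) (uIoc 0 x) volume :=
    intervalIntegrable_iff.1 (Continuous.intervalIntegrable (by fun_prop) _ _)
  calc ‖∫ s in (0 : ℝ)..x, g s‖ ≤ ∫ s in uIoc 0 x, ‖g s‖ := norm_integral_le_integral_norm_uIoc
    _ ≤ ∫ s in uIoc 0 x, K * |s| ^ n :=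
        setIntegral_mono_on (intervalIntegrable_iff.1 (hg.intervalIntegrable_zero hx)).norm hint
          measurableSet_uIoc fun s hs => hK s (hsub hs)
    _ = K * (|x| ^ (n + 1) / (n + 1)) := by
        rw [MeasureTheory.integral_const_mul]
        have := integral_pow_abs_sub_uIoc (a := 0) (b := x) n
        simp only [sub_zero] at this
        rw [this]

lemma eq_add_primitive_zero {G : ℝ → ℂ} (hG : ContinuousOn G (Icc (-a) a))
    (hg : ContinuousOn g (Icc (-a) a)) (hderiv : ∀ x ∈ Ioo (-a) a, HasDerivAt G (g x) x)
    {x : ℝ} (hx : x ∈ Icc (-a) a) : G x = G 0 + ∫ s in (0 : ℝ)..x, g s := by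
  have ha : 0 ≤ a := by linarith [hx.1, hx.2]
  rw [integral_eq_sub_of_hasDeriv_right (hG.mono (uIcc_zero_subset_symm_Icc hx))
    (fun y hy => (hderiv y ⟨?_, ?_⟩).hasDerivWithinAt) (hg.intervalIntegrable_zero hx)]
  · ring
  · exact (le_min (by linarith) hx.1).trans_lt hy.1
  · exact hy.2.trans_le (max_le ha hx.2)

end IntervalEstimates

section RecursiveIntegrals

variable {a : ℝ} {f : ℝ → ℂ}

lemma Xrec_odd (f : ℝ → ℂ) (x₀ : ℝ) (k : ℕ) (x : ℝ) :
    Xrec f x₀ (2 * k + 1) x = (2 * (k : ℂ) + 1) * ∫ s in x₀..x, Xrec f x₀ (2 * k) s * (f s ^ 2)⁻¹ := by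
  simp [Xrec, pow_succ, pow_mul]

lemma Xrec_even (f : ℝ → ℂ) (x₀ : ℝ) (k : ℕ) (x : ℝ) :
    Xrec f x₀ (2 * k + 2) x
      = (2 * (k : ℂ) + 2) * ∫ s in x₀..x, Xrec f x₀ (2 * k + 1) s * f s ^ 2 := by
  rw [Xrec, Even.neg_one_pow ⟨k + 1, by ring⟩]
  simp only [zpow_one]
  push_cast
  ring

lemma continuousOn_Xrec (hf : ContinuousOn f (Icc (-a) a)) (hfne : ∀ x ∈ Icc (-a) a, f x ≠ 0)
    (n : ℕ) : ContinuousOn (Xrec f 0 n) (Icc (-a) a) := by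
  induction n with
  | zero => exact continuousOn_const
  | succ n ih =>
    refine continuousOn_const.mul (ContinuousOn.primitive_zero (ih.mul ?_))
    exact (hf.pow 2).zpow₀ _ fun x hx => Or.inl (pow_ne_zero 2 (hfne x hx))

/-- Coefficients of the sine series. -/
noncomputable def sinCoeff (β : ℂ) (k : ℕ) : ℂ :=
  (-1 : ℂ) ^ k * β ^ (2 * k + 1) / (Nat.factorial (2 * k + 1) : ℂ)

lemma sinCoeff_succ_mul (β : ℂ) (k : ℕ) :
    sinCoeff β (k + 1) * (2 * ((k + 1 : ℕ) : ℂ) + 1) * (2 * (k : ℂ) + 2)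
      = -β ^ 2 * sinCoeff β k := by
  have h1 : (Nat.factorial (2 * (k + 1) + 1) : ℂ)
      = (2 * (k : ℂ) + 3) * ((2 * (k : ℂ) + 2) * (Nat.factorial (2 * k + 1) : ℂ)) := by
    rw [show 2 * (k + 1) + 1 = 2 * k + 1 + 1 + 1 by ring, Nat.factorial_succ, Nat.factorial_succ]
    push_cast
    ring
  have h2 : (Nat.factorial (2 * k + 1) : ℂ) ≠ 0 := by exact_mod_cast Nat.factorial_ne_zero _
  have h3 : (2 * (k : ℂ) + 3) ≠ 0 := by norm_cast
  have h4 : (2 * (k : ℂ) + 2) ≠ 0 := by norm_cast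
  rw [sinCoeff, sinCoeff, h1]
  push_cast
  field_simp
  ring

/-- Partial sums of the series for `V = u / f`. -/
noncomputable def seriesV (f : ℝ → ℂ) (β : ℂ) (n : ℕ) (x : ℝ) : ℂ :=
  ∑ k ∈ Finset.range n, sinCoeff β k * Xrec f 0 (2 * k + 1) x

/-- Partial sums of the series for `W = f ^ 2 * V'`. -/
noncomputable def seriesW (f : ℝ → ℂ) (β : ℂ) (n : ℕ) (x : ℝ) : ℂ :=
  ∑ k ∈ Finset.range n, sinCoeff β k * (2 * (k : ℂ) + 1) * Xrec f 0 (2 * k) x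

lemma continuousOn_seriesV (hf : ContinuousOn f (Icc (-a) a)) (hfne : ∀ x ∈ Icc (-a) a, f x ≠ 0)
    (β : ℂ) (n : ℕ) : ContinuousOn (seriesV f β n) (Icc (-a) a) :=
  continuousOn_finsetSum _ fun _ _ => continuousOn_const.mul (continuousOn_Xrec hf hfne _)

lemma continuousOn_seriesW (hf : ContinuousOn f (Icc (-a) a)) (hfne : ∀ x ∈ Icc (-a) a, f x ≠ 0)
    (β : ℂ) (n : ℕ) : ContinuousOn (seriesW f β n) (Icc (-a) a) :=
  continuousOn_finsetSum _ fun _ _ => continuousOn_const.mul (continuousOn_Xrec hf hfne _)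

lemma seriesV_eq_integral (hf : ContinuousOn f (Icc (-a) a)) (hfne : ∀ x ∈ Icc (-a) a, f x ≠ 0)
    (β : ℂ) (n : ℕ) {x : ℝ} (hx : x ∈ Icc (-a) a) :
    seriesV f β n x = ∫ s in (0 : ℝ)..x, seriesW f β n s * (f s ^ 2)⁻¹ := by
  have hr : ContinuousOn (fun s => (f s ^ 2)⁻¹) (Icc (-a) a) :=
    (hf.pow 2).inv₀ fun x hx => pow_ne_zero 2 (hfne x hx)
  simp only [seriesV, seriesW, Finset.sum_mul, mul_assoc]
  rw [intervalIntegral.integral_finsetSum]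
  · simp only [intervalIntegral.integral_const_mul, Xrec_odd]
  · exact fun k _ => ContinuousOn.intervalIntegrable_zero
      (continuousOn_const.mul (continuousOn_const.mul ((continuousOn_Xrec hf hfne _).mul hr))) hx

lemma seriesW_succ_eq_integral (hf : ContinuousOn f (Icc (-a) a))
    (hfne : ∀ x ∈ Icc (-a) a, f x ≠ 0) (β : ℂ) (n : ℕ) {x : ℝ} (hx : x ∈ Icc (-a) a) :
    seriesW f β (n + 1) x = β + -β ^ 2 * ∫ s in (0 : ℝ)..x, seriesV f β n s * f s ^ 2 := by
  rw [seriesW, Finset.sum_range_succ']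
  simp only [seriesV, Finset.sum_mul, mul_assoc]
  rw [intervalIntegral.integral_finsetSum fun k _ => ?_, add_comm, Finset.mul_sum]
  congr 1
  · simp [sinCoeff, Xrec]
  · refine Finset.sum_congr rfl fun k _ => ?_
    rw [intervalIntegral.integral_const_mul, ← mul_assoc (-β ^ 2), ← sinCoeff_succ_mul,
      show 2 * (k + 1) = 2 * k + 2 by ring, Xrec_even]
    ring
  · exact ContinuousOn.intervalIntegrable_zero
      (continuousOn_const.mul ((continuousOn_Xrec hf hfne _).mul (hf.pow 2))) hx

/-- Remainder estimate for the series solution of the first-order system satisfied by `V`, `W`. -/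
lemma norm_sub_seriesV_le (hf : ContinuousOn f (Icc (-a) a)) (hfne : ∀ x ∈ Icc (-a) a, f x ≠ 0)
    {β : ℂ} {V W : ℝ → ℂ} (hVc : ContinuousOn V (Icc (-a) a)) (hWc : ContinuousOn W (Icc (-a) a))
    (hV : ∀ x ∈ Icc (-a) a, V x = ∫ s in (0 : ℝ)..x, W s * (f s ^ 2)⁻¹)
    (hW : ∀ x ∈ Icc (-a) a, W x = β + -β ^ 2 * ∫ s in (0 : ℝ)..x, V s * f s ^ 2)
    {C M : ℝ} (hC : ∀ x ∈ Icc (-a) a, ‖f x ^ 2‖ ≤ C) (hC' : ∀ x ∈ Icc (-a) a, ‖(f x ^ 2)⁻¹‖ ≤ C)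
    (hM : ∀ x ∈ Icc (-a) a, ‖V x‖ ≤ M) (n : ℕ) :
    ∀ x ∈ Icc (-a) a, ‖V x - seriesV f β n x‖
      ≤ M * (‖β‖ * C) ^ (2 * n) / (Nat.factorial (2 * n) : ℝ) * |x| ^ (2 * n) := by
  have hr : ContinuousOn (fun s => (f s ^ 2)⁻¹) (Icc (-a) a) :=
    (hf.pow 2).inv₀ fun x hx => pow_ne_zero 2 (hfne x hx)
  induction n with
  | zero => simpa [seriesV] using hM
  | succ n ih =>
    set K := M * (‖β‖ * C) ^ (2 * n) / (Nat.factorial (2 * n) : ℝ) with hK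
    have hVn := continuousOn_seriesV hf hfne β n
    have hWn := continuousOn_seriesW hf hfne β (n + 1)
    have hRW : ∀ x ∈ Icc (-a) a, ‖W x - seriesW f β (n + 1) x‖
        ≤ ‖β‖ ^ 2 * (K * C / (2 * n + 1)) * |x| ^ (2 * n + 1) := by
      intro x hx
      have heq : W x - seriesW f β (n + 1) x
          = -β ^ 2 * ∫ s in (0 : ℝ)..x, (V s - seriesV f β n s) * f s ^ 2 := by
        simp only [sub_mul]
        rw [hW x hx, seriesW_succ_eq_integral hf hfne β n hx, intervalIntegral.integral_sub]
        · ring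
        · exact (hVc.mul (hf.pow 2)).intervalIntegrable_zero hx
        · exact (hVn.mul (hf.pow 2)).intervalIntegrable_zero hx
      have hb := norm_primitive_zero_le_pow (K := K * C) (n := 2 * n)
        ((hVc.sub hVn).mul (hf.pow 2)) (fun s hs => by
          have := mul_le_mul (ih s hs) (hC s hs) (norm_nonneg _)
            ((norm_nonneg _).trans (ih s hs))
          calc _ = ‖V s - seriesV f β n s‖ * ‖f s ^ 2‖ := norm_mul _ _
            _ ≤ _ := this
            _ = _ := by ring) hx
      rw [heq, norm_mul, norm_neg, norm_pow]
      refine (mul_le_mul_of_nonneg_left hb (by positivity)).trans_eq ?_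
      push_cast
      ring
    intro x hx
    have heq : V x - seriesV f β (n + 1) x
        = ∫ s in (0 : ℝ)..x, (W s - seriesW f β (n + 1) s) * (f s ^ 2)⁻¹ := by
      simp only [sub_mul]
      rw [hV x hx, seriesV_eq_integral hf hfne β _ hx, intervalIntegral.integral_sub]
      · exact (hWc.mul hr).intervalIntegrable_zero hx
      · exact (hWn.mul hr).intervalIntegrable_zero hx
    have hb := norm_primitive_zero_le_pow (K := ‖β‖ ^ 2 * (K * C / (2 * n + 1)) * C)
      (n := 2 * n + 1) ((hWc.sub hWn).mul hr) (fun s hs => by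
        have := mul_le_mul (hRW s hs) (hC' s hs) (norm_nonneg _)
          ((norm_nonneg _).trans (hRW s hs))
        calc _ = ‖W s - seriesW f β (n + 1) s‖ * ‖(f s ^ 2)⁻¹‖ := norm_mul _ _
          _ ≤ _ := this
          _ = _ := by ring) hx
    rw [heq]
    refine hb.trans_eq ?_
    have hfac : (Nat.factorial (2 * (n + 1)) : ℝ)
        = (2 * n + 2) * ((2 * n + 1) * (Nat.factorial (2 * n) : ℝ)) := by
      rw [show 2 * (n + 1) = 2 * n + 1 + 1 by ring, Nat.factorial_succ, Nat.factorial_succ]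
      push_cast
      ring
    have h0 : (Nat.factorial (2 * n) : ℝ) ≠ 0 := by exact_mod_cast Nat.factorial_ne_zero _
    have h2 : (2 * (n : ℝ) + 2) ≠ 0 := by positivity
    rw [hfac, hK]
    push_cast
    rw [show (2 * (n : ℝ) + 1 + 1) = 2 * n + 2 by ring]
    field_simp
    ring

lemma hasSum_sinCoeff_mul_Xrec (hf : ContinuousOn f (Icc (-a) a))
    (hfne : ∀ x ∈ Icc (-a) a, f x ≠ 0) {β : ℂ} {V W : ℝ → ℂ}
    (hVc : ContinuousOn V (Icc (-a) a)) (hWc : ContinuousOn W (Icc (-a) a))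
    (hV : ∀ x ∈ Icc (-a) a, V x = ∫ s in (0 : ℝ)..x, W s * (f s ^ 2)⁻¹)
    (hW : ∀ x ∈ Icc (-a) a, W x = β + -β ^ 2 * ∫ s in (0 : ℝ)..x, V s * f s ^ 2)
    {x : ℝ} (hx : x ∈ Icc (-a) a) :
    HasSum (fun k => sinCoeff β k * Xrec f 0 (2 * k + 1) x) (V x) := by
  have hr : ContinuousOn (fun s => (f s ^ 2)⁻¹) (Icc (-a) a) :=
    (hf.pow 2).inv₀ fun x hx => pow_ne_zero 2 (hfne x hx)
  obtain ⟨C₁, hC₁⟩ := isCompact_Icc.exists_bound_of_continuousOn (hf.pow 2)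
  obtain ⟨C₂, hC₂⟩ := isCompact_Icc.exists_bound_of_continuousOn hr
  obtain ⟨M, hM⟩ := isCompact_Icc.exists_bound_of_continuousOn hVc
  have hbound (n : ℕ) := norm_sub_seriesV_le hf hfne hVc hWc hV hW
    (fun y hy => (hC₁ y hy).trans (le_max_left C₁ C₂))
    (fun y hy => (hC₂ y hy).trans (le_max_right C₁ C₂)) hM n x hx
  have hsum : Summable fun n => V x - seriesV f β n x := by
    refine Summable.of_norm_bounded ?_ hbound
    have := ((Real.summable_pow_div_factorial (‖β‖ * max C₁ C₂ * |x|)).comp_injective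
      (i := fun n : ℕ => 2 * n) (fun m n h => by simpa using h)).mul_left M
    refine this.congr fun n => ?_
    simp only [Function.comp_apply, mul_pow]
    ring
  have hterm : Summable fun k => sinCoeff β k * Xrec f 0 (2 * k + 1) x := by
    refine (hsum.sub ((summable_nat_add_iff 1).2 hsum)).congr fun k => ?_
    simp only [seriesV, Finset.sum_range_succ]
    ring
  rw [hterm.hasSum_iff_tendsto_nat]
  have := (tendsto_const_nhds (x := V x)).sub hsum.tendsto_atTop_zero
  simpa [seriesV] using this

end RecursiveIntegrals

lemma hasSum_sinCoeff_mul_pow (β z : ℂ) :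
    HasSum (fun k => sinCoeff β k * z ^ (2 * k + 1)) (Complex.sin (β * z)) := by
  refine (Complex.hasSum_sin (β * z)).congr_fun fun k => ?_
  simp only [sinCoeff, mul_pow]
  ring

lemma tendstoUniformlyOn_sinCoeff (β : ℂ) (a : ℝ) :
    TendstoUniformlyOn
      (fun n (t : ℝ) => ∑ k ∈ Finset.range n, sinCoeff β k * (t : ℂ) ^ (2 * k + 1))
      (fun t : ℝ => Complex.sin (β * t)) atTop (Icc (-a) a) := by
  have hs : Summable fun k : ℕ => (‖β‖ * a) ^ (2 * k + 1) / (Nat.factorial (2 * k + 1) : ℝ) :=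
    (Real.summable_pow_div_factorial (‖β‖ * a)).comp_injective
      (i := fun n : ℕ => 2 * n + 1) (fun m n h => by simpa using h)
  have := tendstoUniformlyOn_tsum_nat hs (s := Icc (-a) a)
    (f := fun k (t : ℝ) => sinCoeff β k * (t : ℂ) ^ (2 * k + 1)) fun k t ht => by
      have h1 : |t| ≤ a := abs_le.2 ht
      simp only [sinCoeff, norm_mul, norm_div, norm_pow, norm_neg, norm_one, one_pow, one_mul,
        Complex.norm_real, Real.norm_eq_abs, Complex.norm_natCast, mul_pow]
      rw [div_mul_eq_mul_div]
      gcongr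
  refine this.congr_right fun t _ => ?_
  exact (hasSum_sinCoeff_mul_pow β t).tsum_eq

theorem Th_sin_is_spps_solution (a : ℝ) (ha : 0 < a) (q f : ℝ → ℂ)
    (hq : ContinuousOn q (Icc (-a) a))
    (hf : ContDiffOn ℝ 2 f (Icc (-a) a))
    (hfeq : ∀ x ∈ Icc (-a) a, deriv (deriv f) x = q x * f x)
    (hfne : ∀ x ∈ Icc (-a) a, f x ≠ 0) (hf0 : f 0 = 1)
    (h : ℂ) (hh : h = deriv f 0)
    (Th : (ℝ → ℂ) → (ℝ → ℂ))
    (hadd : ∀ u v : ℝ → ℂ, Th (u + v) = Th u + Th v)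
    (hsmul : ∀ (c : ℂ) (u : ℝ → ℂ), Th (c • u) = c • Th u)
    (hcont : ∀ (g : ℕ → ℝ → ℂ) (glim : ℝ → ℂ),
      TendstoUniformlyOn g glim atTop (Icc (-a) a) →
      TendstoUniformlyOn (fun n => Th (g n)) (Th glim) atTop (Icc (-a) a))
    (hpow : ∀ k : ℕ, ∀ x ∈ Icc (-a) a, Th (fun t : ℝ => (t : ℂ) ^ k) x = phi f 0 k x)
    (β : ℂ) (hβ : β ≠ 0) (u : ℝ → ℂ) (hu : ContDiff ℝ 2 u)
    (hueq : ∀ x ∈ Icc (-a) a, deriv (deriv u) x - q x * u x = (-β ^ 2) * u x)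
    (hu0 : u 0 = 0) (hu0' : deriv u 0 = β) :
    ∀ x ∈ Icc (-a) a,
      u x = Th (fun t : ℝ => Complex.sin (β * t)) x ∧
      Th (fun t : ℝ => Complex.sin (β * t)) x
        = ∑' k : ℕ, (-1 : ℂ) ^ k * β ^ (2 * k + 1) / (Nat.factorial (2 * k + 1) : ℂ)
            * phi f 0 (2 * k + 1) x := by
  have hfc := hf.continuousOn
  have hud : ∀ x, HasDerivAt u (deriv u x) x := fun x =>
    (hu.differentiable (by norm_num) x).hasDerivAt
  have hu' : ContDiff ℝ 1 (deriv u) := hu.deriv'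
  have hudd : ∀ x, HasDerivAt (deriv u) (deriv (deriv u) x) x := fun x =>
    (hu'.differentiable (by norm_num) x).hasDerivAt
  set f' := derivWithin f (Icc (-a) a) with hf'
  have hf'c : ContinuousOn f' (Icc (-a) a) :=
    hf.continuousOn_derivWithin (uniqueDiffOn_Icc (by linarith)) (by norm_num)
  have hf'eq : ∀ x ∈ Ioo (-a) a, f' x = deriv f x := fun x hx =>
    derivWithin_of_mem_nhds (Icc_mem_nhds hx.1 hx.2)
  have hfd : ∀ x ∈ Ioo (-a) a, HasDerivAt f (f' x) x := fun x hx => by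
    rw [hf'eq x hx]
    exact ((hf.contDiffAt (Icc_mem_nhds hx.1 hx.2)).differentiableAt (by norm_num)).hasDerivAt
  have hfdd : ∀ x ∈ Ioo (-a) a, HasDerivAt f' (q x * f x) x := fun x hx => by
    have hd : DifferentiableAt ℝ (deriv f) x := by
      have h2 : ContDiffOn ℝ 1 (deriv f) (Ioo (-a) a) :=
        (hf.mono Ioo_subset_Icc_self).deriv_of_isOpen isOpen_Ioo (by norm_num)
      exact (h2.contDiffAt (isOpen_Ioo.mem_nhds hx)).differentiableAt (by norm_num)
    rw [← hfeq x (Ioo_subset_Icc_self hx)]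
    exact hd.hasDerivAt.congr_of_eventuallyEq
      (eventually_of_mem (isOpen_Ioo.mem_nhds hx) hf'eq)
  have huc : ContinuousOn u (Icc (-a) a) := hu.continuous.continuousOn
  have hu'c : ContinuousOn (deriv u) (Icc (-a) a) := hu'.continuous.continuousOn
  set V : ℝ → ℂ := fun x => u x / f x with hVdef
  set W : ℝ → ℂ := fun x => deriv u x * f x - u x * f' x with hWdef
  have hVc : ContinuousOn V (Icc (-a) a) := huc.div hfc hfne
  have hWc : ContinuousOn W (Icc (-a) a) := (hu'c.mul hfc).sub (huc.mul hf'c)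
  have hV : ∀ x ∈ Icc (-a) a, V x = ∫ s in (0 : ℝ)..x, W s * (f s ^ 2)⁻¹ := fun x hx => by
    rw [eq_add_primitive_zero hVc
      (hWc.mul ((hfc.pow 2).inv₀ fun y hy => pow_ne_zero 2 (hfne y hy)))
      (fun y hy => (hud y).div (hfd y hy) (hfne y (Ioo_subset_Icc_self hy))) hx]
    simp [hVdef, hu0]
  have hW : ∀ x ∈ Icc (-a) a, W x = β + -β ^ 2 * ∫ s in (0 : ℝ)..x, V s * f s ^ 2 :=
      fun x hx => by
    rw [eq_add_primitive_zero (g := fun s => -β ^ 2 * (V s * f s ^ 2)) hWc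
      (continuousOn_const.mul (hVc.mul (hfc.pow 2))) (fun y hy => ?_) hx,
      intervalIntegral.integral_const_mul]
    · simp [hWdef, hu0, hu0', hf0]
    · have hy' := Ioo_subset_Icc_self hy
      have hne := hfne y hy'
      refine (((hudd y).mul (hfd y hy)).sub ((hud y).mul (hfdd y hy))).congr_deriv ?_
      have h1 : V y * f y ^ 2 = u y * f y := by
        simp only [hVdef]
        field_simp
      rw [h1]
      linear_combination f y * hueq y hy'
  intro x hx
  have hsum : HasSum (fun k : ℕ => (-1 : ℂ) ^ k * β ^ (2 * k + 1) / (Nat.factorial (2 * k + 1) : ℂ)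
      * phi f 0 (2 * k + 1) x) (u x) := by
    have h1 := (hasSum_sinCoeff_mul_Xrec hfc hfne hVc hWc hV hW hx).mul_left (f x)
    rw [show f x * V x = u x from mul_div_cancel₀ _ (hfne x hx)] at h1
    refine h1.congr_fun fun k => ?_
    rw [phi, if_pos ⟨k, rfl⟩, sinCoeff]
    ring
  have hlim := (hcont _ _ (tendstoUniformlyOn_sinCoeff β a)).tendsto_at hx
  let T : (ℝ → ℂ) →ₗ[ℂ] (ℝ → ℂ) := { toFun := Th, map_add' := hadd, map_smul' := hsmul }
  have hpartial : ∀ n : ℕ,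
      Th (fun t : ℝ => ∑ k ∈ Finset.range n, sinCoeff β k * (t : ℂ) ^ (2 * k + 1)) x
        = ∑ k ∈ Finset.range n, sinCoeff β k * phi f 0 (2 * k + 1) x := fun n => by
    have h1 : (fun t : ℝ => ∑ k ∈ Finset.range n, sinCoeff β k * (t : ℂ) ^ (2 * k + 1))
        = ∑ k ∈ Finset.range n, sinCoeff β k • fun t : ℝ => (t : ℂ) ^ (2 * k + 1) := by
      ext t
      simp
    rw [h1]
    change T _ x = _
    rw [map_sum, Finset.sum_apply]
    refine Finset.sum_congr rfl fun k _ => ?_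
    rw [map_smul, Pi.smul_apply, smul_eq_mul, ← hpow _ x hx]
    rfl
  simp only [hpartial] at hlim
  have hTh := tendsto_nhds_unique hlim hsum.tendsto_sum_nat
  exact ⟨hTh.symm, hTh.trans hsum.tsum_eq.symm⟩
end
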